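/- Let a and b be natural numbers with j-th decimal digits a_j := (a / 10^{j−1}) mod 10 and b_j := (b / 10^{j−1}) mod 10, and let c_j := ((a + b) / 10^{j−1}) mod 10 be the j-th decimal digit of a + b. For i ≥ 1 define the rational numbers x_i = Σ_{j=1}^{i} a_j · 10^{j−i}, y_i = Σ_{j=1}^{i} b_j · 10^{j−i}, and z_i = Σ_{j=1}^{i−1} c_j · 10^{j−i}. Then c_i = (x_i + y_i − z_i) mod 10, where x_i + y_i − z_i is regarded as an integer and mod denotes the remainder upon division by 10. -/

import Mathlib

theorem digit_sum_aux (s i n : ℕ) :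
    (∑ j ∈ Finset.Icc 1 n,
      ((s / 10 ^ (j - 1) % 10 : ℕ) : ℚ) * (10 : ℚ) ^ ((j : ℤ) - (i : ℤ))) =
    ((s % 10 ^ n : ℕ) : ℚ) * (10 : ℚ) ^ (1 - (i : ℤ)) := by
  induction n with
  | zero => simp [Nat.mod_one]
  | succ n ih =>
    rw [Finset.sum_Icc_succ_top (by omega), ih, Nat.mod_pow_succ, Nat.add_sub_cancel]
    have h : (10 : ℚ) ^ (((n + 1 : ℕ) : ℤ) - (i : ℤ)) = 10 ^ n * (10 : ℚ) ^ (1 - (i : ℤ)) := by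
      rw [← zpow_natCast, ← zpow_add₀ (by norm_num)]
      congr 1
      push_cast
      ring
    rw [h, Nat.cast_add, Nat.cast_mul, Nat.cast_pow]
    push_cast
    ring

theorem digit_eq_combination_mod_ten (a b i : ℕ) (hi : 1 ≤ i) (m : ℤ)
    (hm : (m : ℚ) =
        (∑ j ∈ Finset.Icc 1 i,
            ((a / 10 ^ (j - 1) % 10 : ℕ) : ℚ) * (10 : ℚ) ^ ((j : ℤ) - (i : ℤ))) +
          (∑ j ∈ Finset.Icc 1 i,
            ((b / 10 ^ (j - 1) % 10 : ℕ) : ℚ) * (10 : ℚ) ^ ((j : ℤ) - (i : ℤ))) -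
          (∑ j ∈ Finset.Icc 1 (i - 1),
            (((a + b) / 10 ^ (j - 1) % 10 : ℕ) : ℚ) * (10 : ℚ) ^ ((j : ℤ) - (i : ℤ)))) :
    (((a + b) / 10 ^ (i - 1) % 10 : ℕ) : ℤ) = m % 10 := by
  obtain ⟨k, rfl⟩ : ∃ k, i = k + 1 := ⟨i - 1, by omega⟩
  rw [digit_sum_aux, digit_sum_aux, digit_sum_aux, Nat.add_sub_cancel] at hm
  rw [Nat.add_sub_cancel]
  have h : (10 : ℚ) ^ (1 - ((k + 1 : ℕ) : ℤ)) = ((10 : ℚ) ^ k)⁻¹ := by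
    rw [← zpow_natCast, ← zpow_neg]
    congr 1
    push_cast
    ring
  have hP : (10 : ℚ) ^ k ≠ 0 := by positivity
  rw [h, ← add_mul, ← sub_mul, eq_mul_inv_iff_mul_eq₀ hP] at hm
  have hz : m * 10 ^ k = ((a % 10 ^ (k + 1) : ℕ) : ℤ) + ((b % 10 ^ (k + 1) : ℕ) : ℤ)
      - (((a + b) % 10 ^ k : ℕ) : ℤ) := by
    exact_mod_cast hm
  have ha : ((a % 10 ^ (k + 1) : ℕ) : ℤ) + 10 ^ (k + 1) * ((a / 10 ^ (k + 1) : ℕ) : ℤ) = a := by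
    exact_mod_cast Nat.mod_add_div a (10 ^ (k + 1))
  have hb : ((b % 10 ^ (k + 1) : ℕ) : ℤ) + 10 ^ (k + 1) * ((b / 10 ^ (k + 1) : ℕ) : ℤ) = b := by
    exact_mod_cast Nat.mod_add_div b (10 ^ (k + 1))
  have hc : (((a + b) % 10 ^ k : ℕ) : ℤ) + 10 ^ k * (((a + b) / 10 ^ k : ℕ) : ℤ) = a + b := by
    exact_mod_cast Nat.mod_add_div (a + b) (10 ^ k)
  generalize a / 10 ^ (k + 1) = u at *
  generalize b / 10 ^ (k + 1) = v at *
  generalize (a + b) / 10 ^ k = q at *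
  have hPz : (10 : ℤ) ^ k ≠ 0 := by positivity
  have key : m = (q : ℤ) - 10 * (u + v) := by
    apply mul_right_cancel₀ hPz
    rw [hz]
    linear_combination ha + hb - hc
  omega
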